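/- arXiv:2209.12098 — 4 statements merged into one kernel-verified Lean document; each statement's English description precedes it below -/
import Mathlib

section
/- There exist constants c₁, c₂, c₃ > 0 such that for every θ ∈ (0, π/4), every R > 0, and every s ≥ c₃/(Rθ), the averaged Fourier decay at the frequency ξ = (s, 0) on the positive x-axis satisfies the two-sided estimate c₁·R/(θ·s³) ≤ φ_{R,θ}((s,0)) ≤ c₂·R/(θ·s³). -/
open Real MeasureTheory Set

noncomputable section

/-- Rotation of the plane by angle `ω` about the origin. -/
def rot (ω : ℝ) (p : ℝ × ℝ) : ℝ × ℝ :=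
  (p.1 * Real.cos ω - p.2 * Real.sin ω, p.1 * Real.sin ω + p.2 * Real.cos ω)

/-- Indicator function `1_{r,ν}` of the square `[-r,r]²` rotated counterclockwise by
angle `ν` about the origin. -/
def sqInd (r ν : ℝ) : ℝ × ℝ → ℝ :=
  Set.indicator (rot ν '' (Set.Icc (-r) r ×ˢ Set.Icc (-r) r)) 1

/-- Fourier transform `1̂_{r,ν}(ξ) = ∫_{ℝ²} 1_{r,ν}(x) e^{-2πi x·ξ} dx`. -/
def ftSq (r ν : ℝ) (ξ : ℝ × ℝ) : ℂ :=
  ∫ x : ℝ × ℝ, (sqInd r ν x : ℂ) *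
    Complex.exp (-(2 * (π : ℂ) * Complex.I * ((x.1 * ξ.1 + x.2 * ξ.2 : ℝ) : ℂ)))

/-- Euclidean length `|ξ|` of a plane vector. -/
def nrm (ξ : ℝ × ℝ) : ℝ := Real.sqrt (ξ.1 ^ 2 + ξ.2 ^ 2)

/-- Averaged squared Fourier decay
`φ_{R,θ}(ξ) = (1/(Rθ)) ∫_{R/2}^R ∫_{-θ}^{θ} |1̂_{r,ν}(ξ)|² dν dr`. -/
def phi (R θ : ℝ) (ξ : ℝ × ℝ) : ℝ :=
  (1 / (R * θ)) * ∫ r in (R/2)..R, ∫ ν in (-θ)..θ, ‖ftSq r ν ξ‖ ^ 2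

/-- `ξ` has argument `α`, i.e. `ξ = |ξ|(cos α, sin α)`. -/
def hasArg (ξ : ℝ × ℝ) (α : ℝ) : Prop :=
  ξ = (nrm ξ * Real.cos α, nrm ξ * Real.sin α)

lemma my_one_dim (r a : ℝ) (hr : 0 ≤ r) :
    ∫ y in Set.Icc (-r) r, Complex.exp (((a * y : ℝ) : ℂ) * Complex.I)
      = ((2 * r * Real.sinc (a * r) : ℝ) : ℂ) := by
  rw [integral_Icc_eq_integral_Ioc, ← intervalIntegral.integral_of_le (by linarith)]
  by_cases ha : a = 0
  · subst ha
    simp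
    ring
  · have h := intervalIntegral.integral_comp_mul_left
      (fun t : ℝ => Complex.exp ((t : ℂ) * Complex.I)) (a := -r) (b := r) ha
    rw [h]
    have h2 : a * -r = -(a * r) := by ring
    rw [h2, integral_exp_mul_I_eq_sinc]
    have ha' : (a : ℂ) ≠ 0 := by exact_mod_cast ha
    rw [Complex.real_smul]
    push_cast
    field_simp

lemma my_rot_inj (ν : ℝ) : Function.Injective (rot ν) := by
  intro p q h
  simp only [rot, Prod.mk.injEq] at h
  obtain ⟨h1, h2⟩ := h
  have hc := Real.sin_sq_add_cos_sq ν
  ext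
  · linear_combination Real.cos ν * h1 + Real.sin ν * h2 - (p.1 - q.1) * hc
  · linear_combination Real.cos ν * h2 - Real.sin ν * h1 - (p.2 - q.2) * hc

lemma my_ft (r ν s : ℝ) (hr : 0 ≤ r) :
    ftSq r ν (s, 0) = ((2 * r * Real.sinc (2 * π * r * s * Real.cos ν) *
      (2 * r * Real.sinc (2 * π * r * s * Real.sin ν)) : ℝ) : ℂ) := by
  set S : Set (ℝ × ℝ) := Set.Icc (-r) r ×ˢ Set.Icc (-r) r with hS
  have hSm : MeasurableSet S := measurableSet_Icc.prod measurableSet_Icc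
  set L : (ℝ × ℝ) →L[ℝ] (ℝ × ℝ) := (Matrix.toLin (.finTwoProd ℝ) (.finTwoProd ℝ)
    !![Real.cos ν, -Real.sin ν; Real.sin ν, Real.cos ν]).toContinuousLinearMap with hL
  have hLrot : rot ν = L := by
    funext p
    rw [hL, Matrix.toLin_finTwoProd_toContinuousLinearMap]
    simp [rot]
    constructor <;> ring
  have hdet : L.det = 1 := by
    rw [hL, ContinuousLinearMap.det, LinearMap.coe_toContinuousLinearMap, LinearMap.det_toLin,
      Matrix.det_fin_two_of]
    nlinarith [Real.sin_sq_add_cos_sq ν]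
  have hder : ∀ x ∈ S, HasFDerivWithinAt (rot ν) L S x := by
    intro x _
    rw [hLrot]
    exact L.hasFDerivWithinAt
  have hTm : MeasurableSet (rot ν '' S) := by
    apply IsCompact.measurableSet
    apply (isCompact_Icc.prod isCompact_Icc).image
    rw [hLrot]
    exact L.continuous
  have e1 : ftSq r ν (s, 0) = ∫ x in rot ν '' S,
      Complex.exp (-(2 * (π : ℂ) * Complex.I * ((x.1 * s + x.2 * 0 : ℝ) : ℂ))) := by
    rw [← integral_indicator hTm]
    unfold ftSq sqInd
    congr 1
    funext x
    by_cases hx : x ∈ rot ν '' S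
    · rw [Set.indicator_of_mem hx, Set.indicator_of_mem hx, Pi.one_apply, Complex.ofReal_one,
        one_mul]
    · rw [Set.indicator_of_notMem hx, Set.indicator_of_notMem hx, Complex.ofReal_zero, zero_mul]
  rw [e1, integral_image_eq_integral_abs_det_fderiv_smul volume hSm hder
    ((my_rot_inj ν).injOn)]
  rw [hdet]
  have e2 : ∀ y : ℝ × ℝ, |(1:ℝ)| • Complex.exp (-(2 * (π : ℂ) * Complex.I *
      ((((rot ν y).1 * s + (rot ν y).2 * 0 : ℝ)) : ℂ))) =
      Complex.exp ((((-(2 * π * s * Real.cos ν)) * y.1 : ℝ) : ℂ) * Complex.I) *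
      Complex.exp ((((2 * π * s * Real.sin ν) * y.2 : ℝ) : ℂ) * Complex.I) := by
    intro y
    rw [← Complex.exp_add, abs_one, one_smul]
    congr 1
    simp only [rot]
    push_cast
    ring
  simp_rw [e2]
  rw [hS, Measure.volume_eq_prod, setIntegral_prod_mul
    (fun x : ℝ => Complex.exp ((((-(2 * π * s * Real.cos ν)) * x : ℝ) : ℂ) * Complex.I))
    (fun x : ℝ => Complex.exp ((((2 * π * s * Real.sin ν) * x : ℝ) : ℂ) * Complex.I)),
    my_one_dim _ _ hr, my_one_dim _ _ hr, ← Complex.ofReal_mul]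
  congr 2
  · rw [neg_mul, Real.sinc_neg]
    congr 2
    ring
  · congr 2
    ring

/-- the explicit integrand -/
def myF (s r ν : ℝ) : ℝ := (2 * r * Real.sinc (2 * π * r * s * Real.cos ν) *
      (2 * r * Real.sinc (2 * π * r * s * Real.sin ν))) ^ 2

lemma my_cont (s : ℝ) : Continuous (Function.uncurry (myF s)) := by
  have := Real.continuous_sinc
  unfold myF Function.uncurry
  fun_prop

lemma my_phi (R θ s : ℝ) (hR : 0 < R) :
    phi R θ (s, 0) = (1 / (R * θ)) * ∫ r in (R/2)..R, ∫ ν in (-θ)..θ, myF s r ν := by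
  unfold phi
  congr 1
  apply intervalIntegral.integral_congr
  intro r hr
  rw [uIcc_of_le (by linarith)] at hr
  have hr0 : 0 ≤ r := by linarith [hr.1]
  simp only
  congr 1
  funext ν
  rw [my_ft r ν s hr0, Complex.norm_real, Real.norm_eq_abs, sq_abs, myF]

lemma my_mul_sinc (x : ℝ) : x * Real.sinc x = Real.sin x := by
  by_cases h : x = 0
  · simp [h]
  · rw [Real.sinc_of_ne_zero h]; field_simp

lemma my_sinc_sq (x : ℝ) : Real.sinc x ^ 2 * (1 + x ^ 2) ≤ 2 := by
  have h1 := my_mul_sinc x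
  have h2 := Real.sin_sq_le_one x
  have h3 : Real.sinc x ^ 2 ≤ 1 := by
    rw [sq_le_one_iff_abs_le_one]; exact Real.abs_sinc_le_one x
  rw [← h1] at h2
  nlinarith

lemma my_sin_lower (ν : ℝ) (h : |ν| ≤ π / 2) : (2 / π * ν) ^ 2 ≤ Real.sin ν ^ 2 := by
  have key : ∀ x : ℝ, 0 ≤ x → x ≤ π / 2 → (2 / π * x) ^ 2 ≤ Real.sin x ^ 2 := by
    intro x h0 h1
    have := Real.mul_le_sin h0 h1
    have hp : 0 ≤ 2 / π * x := by positivity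
    exact pow_le_pow_left₀ hp this 2
  rcases abs_cases ν with ⟨h1, h2⟩ | ⟨h1, h2⟩
  · exact key ν h2 (by linarith)
  · have := key (-ν) (by linarith) (by linarith)
    simpa using this

lemma my_cos_lower (ν : ℝ) (h : |ν| ≤ π / 4) : 1 / 2 ≤ Real.cos ν ^ 2 := by
  have h1 : Real.cos (π / 4) ≤ Real.cos |ν| :=
    Real.cos_le_cos_of_nonneg_of_le_pi (abs_nonneg _) (by linarith [Real.pi_pos]) h
  rw [Real.cos_abs, Real.cos_pi_div_four] at h1
  have h2 := pow_le_pow_left₀ (by positivity) h1 2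
  rw [div_pow, Real.sq_sqrt (by norm_num)] at h2
  linarith

lemma my_F_upper (s r ν : ℝ) (hs : 0 < s) (hr : 0 < r) (h : |ν| ≤ π / 4) :
    myF s r ν ≤ (16 * r ^ 2 / (π ^ 2 * s ^ 2)) * (1 + (4 * r * s * ν) ^ 2)⁻¹ := by
  have hp := Real.pi_pos
  set A := Real.sinc (2 * π * r * s * Real.cos ν) with hA
  set B := Real.sinc (2 * π * r * s * Real.sin ν) with hB
  have hA1 : A ^ 2 ≤ 1 / (2 * π ^ 2 * r ^ 2 * s ^ 2) := by
    have h1 := my_mul_sinc (2 * π * r * s * Real.cos ν)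
    have h2 := Real.sin_sq_le_one (2 * π * r * s * Real.cos ν)
    rw [← h1, ← hA] at h2
    have h3 := my_cos_lower ν h
    rw [le_div_iff₀ (by positivity)]
    have h4 : 0 ≤ A ^ 2 * (4 * π ^ 2 * r ^ 2 * s ^ 2) := by positivity
    nlinarith [mul_le_mul_of_nonneg_left h3 h4]
  have hB1 : B ^ 2 ≤ 2 * (1 + (4 * r * s * ν) ^ 2)⁻¹ := by
    have h1 := my_sinc_sq (2 * π * r * s * Real.sin ν)
    rw [← hB] at h1
    have h2 := my_sin_lower ν (by linarith)
    rw [← div_eq_mul_inv, le_div_iff₀ (by positivity)]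
    have h3 : (4 * r * s * ν) ^ 2 ≤ (2 * π * r * s * Real.sin ν) ^ 2 := by
      have : (4 * r * s * ν) ^ 2 = (2 * π * r * s) ^ 2 * (2 / π * ν) ^ 2 := by
        field_simp; ring
      rw [this, mul_pow (2 * π * r * s)]
      exact mul_le_mul_of_nonneg_left h2 (by positivity)
    nlinarith [sq_nonneg B]
  have : myF s r ν = 16 * r ^ 4 * (A ^ 2 * B ^ 2) := by
    unfold myF; ring
  rw [this]
  calc 16 * r ^ 4 * (A ^ 2 * B ^ 2) ≤ 16 * r ^ 4 * ((1 / (2 * π ^ 2 * r ^ 2 * s ^ 2)) *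
      (2 * (1 + (4 * r * s * ν) ^ 2)⁻¹)) := by gcongr
    _ = _ := by field_simp

lemma my_inner_upper (s r θ : ℝ) (hs : 0 < s) (hr : 0 < r) (h0 : 0 < θ) (h : θ < π / 4) :
    ∫ ν in (-θ)..θ, myF s r ν ≤ 4 * r / (π * s ^ 3) := by
  have hp := Real.pi_pos
  have hc : Continuous (myF s r) := (my_cont s).comp (Continuous.prodMk_right r)
  have hc2 : Continuous (fun ν : ℝ => (16 * r ^ 2 / (π ^ 2 * s ^ 2)) *
      (1 + (4 * r * s * ν) ^ 2)⁻¹) := by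
    apply Continuous.mul continuous_const
    apply Continuous.inv₀ (by fun_prop)
    intro x; positivity
  have h1 : ∫ ν in (-θ)..θ, myF s r ν ≤ ∫ ν in (-θ)..θ, (16 * r ^ 2 / (π ^ 2 * s ^ 2)) *
      (1 + (4 * r * s * ν) ^ 2)⁻¹ := by
    apply intervalIntegral.integral_mono_on (by linarith) (hc.intervalIntegrable _ _)
      (hc2.intervalIntegrable _ _)
    intro ν hν
    exact my_F_upper s r ν hs hr (abs_le.2 ⟨by linarith [hν.1], by linarith [hν.2]⟩)
  refine h1.trans ?_
  rw [intervalIntegral.integral_const_mul, intervalIntegral.integral_comp_mul_left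
    (fun x : ℝ => (1 + x ^ 2)⁻¹) (by positivity : 4 * r * s ≠ 0), integral_inv_one_add_sq]
  have h2 := Real.arctan_lt_pi_div_two (4 * r * s * θ)
  have h3 := Real.neg_pi_div_two_lt_arctan (4 * r * s * -θ)
  rw [smul_eq_mul]
  calc _ ≤ 16 * r ^ 2 / (π ^ 2 * s ^ 2) * ((4 * r * s)⁻¹ * π) := by
        gcongr; linarith
    _ = _ := by field_simp; norm_num

lemma my_outer_cont (s θ : ℝ) : Continuous (fun r => ∫ ν in (-θ)..θ, myF s r ν) :=
  intervalIntegral.continuous_parametric_intervalIntegral_of_continuous' (my_cont s) _ _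

lemma my_upper (R s θ : ℝ) (hR : 0 < R) (hs : 0 < s) (h0 : 0 < θ) (h : θ < π / 4) :
    phi R θ (s, 0) ≤ 1 * R / (θ * s ^ 3) := by
  have hp := Real.pi_gt_three
  rw [my_phi R θ s hR]
  have h1 : ∫ r in (R/2)..R, ∫ ν in (-θ)..θ, myF s r ν ≤ ∫ r in (R/2)..R, 4 * R / (π * s ^ 3) := by
    apply intervalIntegral.integral_mono_on (by linarith)
      ((my_outer_cont s θ).intervalIntegrable _ _) (by simp)
    intro r hr
    refine (my_inner_upper s r θ hs (by linarith [hr.1]) h0 h).trans ?_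
    have := hr.2
    gcongr
  rw [intervalIntegral.integral_const, smul_eq_mul] at h1
  calc _ ≤ (1 / (R * θ)) * ((R - R / 2) * (4 * R / (π * s ^ 3))) := by gcongr
    _ = (2 / π) * (R / (θ * s ^ 3)) := by field_simp; ring
    _ ≤ 1 * (R / (θ * s ^ 3)) := by
        gcongr
        rw [div_le_one (by linarith)]; linarith
    _ = _ := by ring

lemma my_F_lower (R s r ν : ℝ) (hR : 0 < R) (hs : 0 < s) (hr1 : R / 2 ≤ r) (hr2 : r ≤ R)
    (hRs : 1 ≤ R * s) (h : |ν| ≤ 1 / (10 * (R * s))) :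
    R ^ 2 / (4 * π ^ 2 * s ^ 2) * (Real.sin (2 * π * s * r) ^ 2 / 2 - 1 / 900) ≤ myF s r ν := by
  have hp := Real.pi_pos
  have hp3 := Real.pi_gt_three
  have hp4 := Real.pi_lt_d2
  have hr : 0 < r := by linarith
  set A := Real.sinc (2 * π * r * s * Real.cos ν) with hA
  set B := Real.sinc (2 * π * r * s * Real.sin ν) with hB
  have hF : myF s r ν = 16 * r ^ 4 * (A ^ 2 * B ^ 2) := by
    unfold myF; ring
  -- lower bound for B
  have hB1 : 1 / 4 ≤ B ^ 2 := by
    set x := 2 * π * r * s * Real.sin ν with hx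
    have hxa : |x| ≤ π / 2 := by
      rw [hx, abs_mul, abs_of_pos (by positivity : 0 < 2 * π * r * s)]
      have h1 : |Real.sin ν| ≤ 1 / (10 * (R * s)) := Real.abs_sin_le_abs.trans h
      calc 2 * π * r * s * |Real.sin ν| ≤ 2 * π * R * s * (1 / (10 * (R * s))) := by gcongr
        _ = π / 5 := by field_simp; norm_num
        _ ≤ π / 2 := by linarith
    have h2 := my_sin_lower x hxa
    by_cases hx0 : x = 0
    · rw [hB, hx0]; norm_num
    · rw [← my_mul_sinc x, mul_pow, mul_pow] at h2
      have hx2 : 0 < x ^ 2 := by positivity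
      have h3 : (2 / π) ^ 2 ≤ B ^ 2 := by
        rw [hB]; nlinarith
      refine le_trans ?_ h3
      rw [div_pow, le_div_iff₀ (by positivity)]
      nlinarith
  -- lower bound for A
  have hA1 : Real.sin (2 * π * r * s * Real.cos ν) ^ 2 ≤ 4 * π ^ 2 * r ^ 2 * s ^ 2 * A ^ 2 := by
    rw [← my_mul_sinc, ← hA]
    have h1 := Real.cos_sq_le_one ν
    have h4 : 0 ≤ A ^ 2 * (4 * π ^ 2 * r ^ 2 * s ^ 2) := by positivity
    nlinarith [mul_le_mul_of_nonneg_left h1 h4]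
  have hdiff : |Real.sin (2 * π * s * r) - Real.sin (2 * π * r * s * Real.cos ν)| ≤ 1 / 30 := by
    refine (Real.abs_sin_sub_sin_le _ _).trans ?_
    have e : 2 * π * s * r - 2 * π * r * s * Real.cos ν = 2 * π * r * s * (1 - Real.cos ν) := by
      ring
    have h1 := Real.one_sub_sq_div_two_le_cos (x := ν)
    have h2 := Real.cos_le_one ν
    rw [e, abs_of_nonneg (mul_nonneg (by positivity) (by linarith))]
    have h3 : ν ^ 2 ≤ (1 / (10 * (R * s))) ^ 2 := by
      rw [← sq_abs]; gcongr
    calc 2 * π * r * s * (1 - Real.cos ν)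
        ≤ 2 * π * R * s * ((1 / (10 * (R * s))) ^ 2 / 2) := by
          gcongr
          linarith
      _ = π / 100 * (1 / (R * s)) := by field_simp; norm_num
      _ ≤ π / 100 * 1 := by
          gcongr
          rw [div_le_one (by positivity)]; exact hRs
      _ ≤ 1 / 30 := by linarith
  have hsin : Real.sin (2 * π * s * r) ^ 2 / 2 - 1 / 900 ≤
      Real.sin (2 * π * r * s * Real.cos ν) ^ 2 := by
    obtain ⟨h1, h2⟩ := abs_le.1 hdiff
    have h3 : (Real.sin (2 * π * s * r) - Real.sin (2 * π * r * s * Real.cos ν)) ^ 2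
        ≤ (1 / 30) ^ 2 := sq_le_sq' h1 h2
    nlinarith [sq_nonneg (Real.sin (2 * π * s * r) - 2 * Real.sin (2 * π * r * s * Real.cos ν))]
  calc _ ≤ R ^ 2 / (4 * π ^ 2 * s ^ 2) * (4 * π ^ 2 * r ^ 2 * s ^ 2 * A ^ 2) := by
        gcongr; exact hsin.trans hA1
    _ = R ^ 2 * (r ^ 2 * A ^ 2) := by field_simp
    _ ≤ (2 * r) ^ 2 * (r ^ 2 * A ^ 2) := by gcongr; linarith
    _ = 16 * r ^ 4 * (A ^ 2 * (1 / 4)) := by ring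
    _ ≤ 16 * r ^ 4 * (A ^ 2 * B ^ 2) := by gcongr
    _ = _ := hF.symm

lemma my_F_nonneg (s r ν : ℝ) : 0 ≤ myF s r ν := sq_nonneg _

lemma my_inner_lower (R s r θ : ℝ) (hR : 0 < R) (hs : 0 < s) (hr1 : R / 2 ≤ r) (hr2 : r ≤ R)
    (hRs : 1 ≤ R * s) (h : 1 / (10 * (R * s)) ≤ θ) :
    R / (20 * π ^ 2 * s ^ 3) * (Real.sin (2 * π * s * r) ^ 2 / 2 - 1 / 900)
      ≤ ∫ ν in (-θ)..θ, myF s r ν := by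
  have hp := Real.pi_pos
  have hc : Continuous (myF s r) := (my_cont s).comp (Continuous.prodMk_right r)
  set d := 1 / (10 * (R * s)) with hd
  have hd0 : 0 < d := by positivity
  have h1 : ∫ ν in (-d)..d, R ^ 2 / (4 * π ^ 2 * s ^ 2) *
      (Real.sin (2 * π * s * r) ^ 2 / 2 - 1 / 900) ≤ ∫ ν in (-d)..d, myF s r ν := by
    apply intervalIntegral.integral_mono_on (by linarith) (by simp) (hc.intervalIntegrable _ _)
    intro ν hν
    exact my_F_lower R s r ν hR hs hr1 hr2 hRs (abs_le.2 hν)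
  have h2 : ∫ ν in (-d)..d, myF s r ν ≤ ∫ ν in (-θ)..θ, myF s r ν := by
    apply intervalIntegral.integral_mono_interval (by linarith) (by linarith) h
    · exact Filter.Eventually.of_forall (fun ν => my_F_nonneg s r ν)
    · exact hc.intervalIntegrable _ _
  refine le_trans (le_of_eq ?_) (h1.trans h2)
  rw [intervalIntegral.integral_const, smul_eq_mul, hd]
  field_simp
  ring

lemma my_lower (R s θ : ℝ) (hR : 0 < R) (hs : 0 < s) (h0 : 0 < θ)
    (hRs : 1 ≤ R * s) (h : 1 / (10 * (R * s)) ≤ θ) :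
    (1 / 4000) * R / (θ * s ^ 3) ≤ phi R θ (s, 0) := by
  have hp := Real.pi_pos
  have hp3 := Real.pi_gt_three
  have hp4 := Real.pi_lt_d2
  rw [my_phi R θ s hR]
  have h1 : ∫ r in (R/2)..R, R / (20 * π ^ 2 * s ^ 3) *
      (Real.sin (2 * π * s * r) ^ 2 / 2 - 1 / 900)
      ≤ ∫ r in (R/2)..R, ∫ ν in (-θ)..θ, myF s r ν := by
    apply intervalIntegral.integral_mono_on (by linarith)
      (Continuous.intervalIntegrable (by fun_prop) _ _)
      ((my_outer_cont s θ).intervalIntegrable _ _)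
    intro r hr
    exact my_inner_lower R s r θ hR hs hr.1 hr.2 hRs h
  have h2 : R / 20 ≤ ∫ r in (R/2)..R, (Real.sin (2 * π * s * r) ^ 2 / 2 - 1 / 900) := by
    rw [intervalIntegral.integral_sub (Continuous.intervalIntegrable (by fun_prop) _ _) (by simp),
      intervalIntegral.integral_div, intervalIntegral.integral_comp_mul_left
      (fun x : ℝ => Real.sin x ^ 2) (by positivity : 2 * π * s ≠ 0), integral_sin_sq,
      intervalIntegral.integral_const, smul_eq_mul, smul_eq_mul]
    have key : ∀ x : ℝ, |Real.sin x * Real.cos x| ≤ 1 / 2 := by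
      intro x
      rw [abs_le]
      constructor <;> nlinarith [Real.sin_sq_add_cos_sq x, sq_nonneg (Real.sin x + Real.cos x),
        sq_nonneg (Real.sin x - Real.cos x)]
    have k1 := (abs_le.1 (key (2 * π * s * (R / 2)))).1
    have k2 := (abs_le.1 (key (2 * π * s * R))).2
    set a := Real.sin (2 * π * s * (R / 2)) * Real.cos (2 * π * s * (R / 2))
    set b := Real.sin (2 * π * s * R) * Real.cos (2 * π * s * R)
    have e : (2 * π * s)⁻¹ * ((a - b + 2 * π * s * R - 2 * π * s * (R / 2)) / 2) / 2
        = R / 8 - (2 * π * s)⁻¹ * (b - a) / 4 := by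
      field_simp; ring
    rw [e]
    have k3 : (2 * π * s)⁻¹ * (b - a) ≤ R / 6 := by
      rw [inv_mul_le_iff₀ (by positivity)]
      nlinarith
    linarith
  rw [intervalIntegral.integral_const_mul] at h1
  calc _ = (1 / (R * θ)) * (R / (20 * (10 : ℝ) * s ^ 3) * (R / 20)) := by field_simp; norm_num
    _ ≤ (1 / (R * θ)) * (R / (20 * π ^ 2 * s ^ 3) * (R / 20)) := by
        gcongr; nlinarith
    _ ≤ (1 / (R * θ)) * (R / (20 * π ^ 2 * s ^ 3) *
        ∫ r in (R/2)..R, (Real.sin (2 * π * s * r) ^ 2 / 2 - 1 / 900)) := by gcongr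
    _ ≤ _ := by gcongr

/-- **Two-sided estimate on the positive x-axis.** There are constants `c₁, c₂, c₃ > 0`
such that for every `θ ∈ (0, π/4)`, `R > 0` and `s ≥ c₃/(Rθ)`,
`c₁ R/(θ s³) ≤ φ_{R,θ}((s,0)) ≤ c₂ R/(θ s³)`. -/
theorem phi_two_sided_on_axis :
    ∃ c₁ > (0:ℝ), ∃ c₂ > (0:ℝ), ∃ c₃ > (0:ℝ), ∀ θ : ℝ, θ ∈ Set.Ioo 0 (π/4) →
      ∀ R : ℝ, 0 < R → ∀ s : ℝ, c₃ / (R * θ) ≤ s →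
        c₁ * R / (θ * s ^ 3) ≤ phi R θ (s, 0) ∧
        phi R θ (s, 0) ≤ c₂ * R / (θ * s ^ 3) := by
  refine ⟨1 / 4000, by norm_num, 1, by norm_num, 1, by norm_num, ?_⟩
  intro θ hθ R hR s hs
  obtain ⟨h0, h1⟩ := hθ
  have hs0 : 0 < s := lt_of_lt_of_le (by positivity) hs
  have hp4 := Real.pi_lt_d2
  rw [div_le_iff₀ (by positivity)] at hs
  have hRs0 : 0 < R * s := by positivity
  have hRs : 1 ≤ R * s := by nlinarith
  refine ⟨my_lower R s θ hR hs0 h0 hRs ?_, my_upper R s θ hR hs0 h0 h1⟩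
  rw [div_le_iff₀ (by positivity)]
  nlinarith
end
end

section
/- Let p₁, …, p_N be N points in the torus T² = (ℝ/ℤ)². Then for any positive real numbers X₁ and X₂, ∑_{k ∈ ℤ², k ≠ (0,0), |k₁| ≤ X₁, |k₂| ≤ X₂} | ∑_{j=1}^N e^{2πi k·p_j} |² ≥ N·X₁·X₂ − N². -/
open Real MeasureTheory

lemma gram_identity {ι κ : Type*} (s : Finset ι) (T : Finset κ) (a : ι → κ → ℂ) :
    ∑ u ∈ T, ∑ v ∈ T, ‖∑ j ∈ s, a j u * (starRingEnd ℂ) (a j v)‖ ^ 2 =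
      ∑ j ∈ s, ∑ l ∈ s, ‖∑ u ∈ T, a j u * (starRingEnd ℂ) (a l u)‖ ^ 2 := by
  have h : (∑ u ∈ T, ∑ v ∈ T, ((‖∑ j ∈ s, a j u * (starRingEnd ℂ) (a j v)‖ ^ 2 : ℝ) : ℂ)) =
      ∑ j ∈ s, ∑ l ∈ s, ((‖∑ u ∈ T, a j u * (starRingEnd ℂ) (a l u)‖ ^ 2 : ℝ) : ℂ) := by
    push_cast
    simp only [← Complex.mul_conj', map_sum, map_mul, Complex.conj_conj, Finset.sum_mul_sum]
    simp only [← Finset.sum_product']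
    refine Finset.sum_nbij' (fun x => (x.2.2.1, x.2.2.2, x.1, x.2.1))
      (fun x => (x.2.2.1, x.2.2.2, x.1, x.2.1)) ?_ ?_ ?_ ?_ ?_
    · intro x hx
      simp only [Finset.mem_product] at *
      tauto
    · intro x hx
      simp only [Finset.mem_product] at *
      tauto
    · intro x _
      rfl
    · intro x _
      rfl
    · intro x _
      ring
  exact_mod_cast h

/-- Full-box lower bound. -/
lemma full_box_bound (N : ℕ) (χ : Fin N → ℤ × ℤ → ℂ)
    (hχ : ∀ j u v, χ j (u - v) = χ j u * (starRingEnd ℂ) (χ j v))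
    (hn : ∀ j u, ‖χ j u‖ = 1) (K L : ℤ) (hK : 0 ≤ K) (hL : 0 ≤ L) :
    (N : ℝ) * ((K + 1) * (L + 1)) ≤
      ∑ k ∈ Finset.Icc (-K) K ×ˢ Finset.Icc (-L) L, ‖∑ j, χ j k‖ ^ 2 := by
  set T : Finset (ℤ × ℤ) := Finset.Icc 0 K ×ˢ Finset.Icc 0 L with hT
  set B := Finset.Icc (-K) K ×ˢ Finset.Icc (-L) L with hB
  have hcard : (T.card : ℝ) = (K + 1) * (L + 1) := by
    have h1 : (((K + 1).toNat : ℤ)) = K + 1 := Int.toNat_of_nonneg (by omega)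
    have h2 : (((L + 1).toNat : ℤ)) = L + 1 := Int.toNat_of_nonneg (by omega)
    have : (T.card : ℤ) = (K + 1) * (L + 1) := by
      rw [hT, Finset.card_product, Int.card_Icc, Int.card_Icc]
      push_cast [sub_zero]
      rw [h1, h2]
    exact_mod_cast this
  have hpos : (0 : ℝ) < T.card := by
    rw [hcard]
    have : (0 : ℝ) ≤ K := by exact_mod_cast hK
    have : (0 : ℝ) ≤ L := by exact_mod_cast hL
    positivity
  have hup : ∑ v ∈ T, ∑ u ∈ T, ‖∑ j, χ j (u - v)‖ ^ 2 ≤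
      T.card * ∑ k ∈ B, ‖∑ j, χ j k‖ ^ 2 := by
    rw [← nsmul_eq_mul]
    refine Finset.sum_le_card_nsmul _ _ _ fun v hv => ?_
    rw [← Finset.sum_image (s := T) (g := fun u => u - v) (f := fun k => ‖∑ j, χ j k‖ ^ 2)
      (fun x _ y _ h => by simpa using h)]
    refine Finset.sum_le_sum_of_subset_of_nonneg ?_ fun _ _ _ => by positivity
    intro k hk
    obtain ⟨u, hu, rfl⟩ := Finset.mem_image.1 hk
    simp only [hT, hB, Finset.mem_product, Finset.mem_Icc, Prod.fst_sub, Prod.snd_sub] at *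
    omega
  have hlow : (N : ℝ) * (T.card : ℝ) ^ 2 ≤ ∑ v ∈ T, ∑ u ∈ T, ‖∑ j, χ j (u - v)‖ ^ 2 := by
    rw [Finset.sum_comm]
    simp only [hχ]
    rw [gram_identity]
    have : ∀ j ∈ (Finset.univ : Finset (Fin N)), (T.card : ℝ) ^ 2 ≤
        ∑ l, ‖∑ u ∈ T, χ j u * (starRingEnd ℂ) (χ l u)‖ ^ 2 := by
      intro j _
      have h := Finset.single_le_sum
        (f := fun l => ‖∑ u ∈ T, χ j u * (starRingEnd ℂ) (χ l u)‖ ^ 2)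
        (fun _ _ => by positivity) (Finset.mem_univ j)
      simpa [Complex.mul_conj', hn] using h
    simpa using Finset.card_nsmul_le_sum _ _ _ this
  rw [← hcard]
  have := hlow.trans hup
  refine le_of_mul_le_mul_left ?_ hpos
  linarith

/-- **Montgomery's lemma.** For any `N` points `p₁, …, p_N` in the torus `T² = (ℝ/ℤ)²` and
any positive reals `X₁, X₂`,
`∑_{0 ≠ k ∈ ℤ², |k₁| ≤ X₁, |k₂| ≤ X₂} |∑_j e^{2πi k·p_j}|² ≥ N X₁ X₂ − N²`. -/
theorem montgomery_exponential_sum_lower_bound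
    (N : ℕ) (p : Fin N → AddCircle (1:ℝ) × AddCircle (1:ℝ))
    (X₁ X₂ : ℝ) (hX₁ : 0 < X₁) (hX₂ : 0 < X₂) :
    (N : ℝ) * X₁ * X₂ - (N : ℝ) ^ 2 ≤
      ∑ k ∈ (Finset.Icc (-⌊X₁⌋) ⌊X₁⌋ ×ˢ Finset.Icc (-⌊X₂⌋) ⌊X₂⌋).filter
          (fun k : ℤ × ℤ => k ≠ 0 ∧ |(k.1 : ℝ)| ≤ X₁ ∧ |(k.2 : ℝ)| ≤ X₂),
        ‖∑ j : Fin N, fourier k.1 (p j).1 * fourier k.2 (p j).2‖ ^ 2 := by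
  have hK : 0 ≤ ⌊X₁⌋ := Int.floor_nonneg.2 hX₁.le
  have hL : 0 ≤ ⌊X₂⌋ := Int.floor_nonneg.2 hX₂.le
  have hsub : ∀ (m n : ℤ) (x : AddCircle (1:ℝ)),
      fourier (m - n) x = fourier m x * (starRingEnd ℂ) (fourier n x) := by
    intro m n x
    rw [sub_eq_add_neg, fourier_add, fourier_neg]
  have key := full_box_bound N (fun j k => fourier k.1 (p j).1 * fourier k.2 (p j).2)
    (fun j u v => by
      have e1 : fourier (u - v).1 (p j).1 =
          fourier u.1 (p j).1 * (starRingEnd ℂ) (fourier v.1 (p j).1) := hsub _ _ _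
      have e2 : fourier (u - v).2 (p j).2 =
          fourier u.2 (p j).2 * (starRingEnd ℂ) (fourier v.2 (p j).2) := hsub _ _ _
      rw [e1, e2, map_mul]
      ring)
    (fun j u => by
      rw [norm_mul, fourier_apply, fourier_apply, Circle.norm_coe, Circle.norm_coe, mul_one]) ⌊X₁⌋ ⌊X₂⌋ hK hL
  have habs : ∀ (X : ℝ) (k : ℤ), -⌊X⌋ ≤ k → k ≤ ⌊X⌋ → |(k : ℝ)| ≤ X := by
    intro X k h1 h2
    have h3 : (⌊X⌋ : ℝ) ≤ X := Int.floor_le X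
    have h1' : -(⌊X⌋ : ℝ) ≤ k := by exact_mod_cast h1
    have h2' : (k : ℝ) ≤ ⌊X⌋ := by exact_mod_cast h2
    exact abs_le.2 ⟨by linarith, by linarith⟩
  have hset : (Finset.Icc (-⌊X₁⌋) ⌊X₁⌋ ×ˢ Finset.Icc (-⌊X₂⌋) ⌊X₂⌋).filter
          (fun k : ℤ × ℤ => k ≠ 0 ∧ |(k.1 : ℝ)| ≤ X₁ ∧ |(k.2 : ℝ)| ≤ X₂) =
      (Finset.Icc (-⌊X₁⌋) ⌊X₁⌋ ×ˢ Finset.Icc (-⌊X₂⌋) ⌊X₂⌋).erase 0 := by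
    ext k
    simp only [Finset.mem_filter, Finset.mem_erase, Finset.mem_product, Finset.mem_Icc]
    constructor
    · rintro ⟨h, h0, -⟩
      exact ⟨h0, h⟩
    · rintro ⟨h0, h⟩
      exact ⟨h, h0, habs _ _ h.1.1 h.1.2, habs _ _ h.2.1 h.2.2⟩
  have h0 : (0 : ℤ × ℤ) ∈ Finset.Icc (-⌊X₁⌋) ⌊X₁⌋ ×ˢ Finset.Icc (-⌊X₂⌋) ⌊X₂⌋ := by
    simp only [Finset.mem_product, Finset.mem_Icc, Prod.fst_zero, Prod.snd_zero]
    omega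
  rw [← Finset.add_sum_erase _ _ h0] at key
  rw [hset]
  have hz : ‖∑ j : Fin N, fourier (0 : ℤ × ℤ).1 (p j).1 * fourier (0 : ℤ × ℤ).2 (p j).2‖ ^ 2
      = (N : ℝ) ^ 2 := by simp
  rw [hz] at key
  have hX : X₁ * X₂ ≤ ((⌊X₁⌋ : ℝ) + 1) * ((⌊X₂⌋ : ℝ) + 1) :=
    mul_le_mul (Int.lt_floor_add_one X₁).le (Int.lt_floor_add_one X₂).le hX₂.le
      (hX₁.le.trans (Int.lt_floor_add_one X₁).le)
  have := mul_le_mul_of_nonneg_left hX (Nat.cast_nonneg (α := ℝ) N)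
  linarith
end

section
/- Let B be a bounded open neighborhood of the origin in ℝ². Then there is a positive constant c (depending only on B) such that for every convex symmetric body U in ℝ² and every finite set {p₁, …, p_N} ⊂ T², ∑_{m ∈ (U \ B) ∩ ℤ²} | ∑_{j=1}^N e^{2πi m·p_j} |² ≥ N·area(U)/4 − c·N². -/
open Real MeasureTheory

noncomputable section

/-- The lattice point `m ∈ ℤ²` viewed as a point of `ℝ²`. -/
def toR2 (m : ℤ × ℤ) : ℝ × ℝ := ((m.1 : ℝ), (m.2 : ℝ))

lemma mcb_frob {ι : Type*} (A : Finset ι) (N : ℕ) (E : ι → Fin N → ℂ) :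
    ∑ a ∈ A, ∑ b ∈ A, ‖∑ j, E a j * (starRingEnd ℂ) (E b j)‖ ^ 2
      = ∑ j, ∑ k, ‖∑ a ∈ A, E a j * (starRingEnd ℂ) (E a k)‖ ^ 2 := by
  have key : ∀ z : ℂ, ((‖z‖ ^ 2 : ℝ) : ℂ) = z * (starRingEnd ℂ) z := by
    intro z
    rw [Complex.mul_conj, Complex.normSq_eq_norm_sq]
  apply Complex.ofReal_injective
  rw [Complex.ofReal_sum, Complex.ofReal_sum]
  simp_rw [Complex.ofReal_sum, key, map_sum, Finset.sum_mul_sum, map_mul, Complex.conj_conj]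
  have h1 : ∀ a ∈ A, ∑ b ∈ A, ∑ j, ∑ k, E a j * (starRingEnd ℂ) (E b j) *
      ((starRingEnd ℂ) (E a k) * E b k) = ∑ j, ∑ k, ∑ b ∈ A, E a j * (starRingEnd ℂ) (E b j) *
      ((starRingEnd ℂ) (E a k) * E b k) := by
    intro a _
    rw [Finset.sum_comm]
    refine Finset.sum_congr rfl fun j _ => ?_
    rw [Finset.sum_comm]
  rw [Finset.sum_congr rfl h1, Finset.sum_comm]
  refine Finset.sum_congr rfl fun j _ => ?_
  rw [Finset.sum_comm]
  refine Finset.sum_congr rfl fun k _ => ?_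
  refine Finset.sum_congr rfl fun a _ => ?_
  refine Finset.sum_congr rfl fun b _ => ?_
  ring

lemma mcb_diag {ι : Type*} (A : Finset ι) (N : ℕ) (E : ι → Fin N → ℂ)
    (hE : ∀ a j, ‖E a j‖ = 1) :
    (N : ℝ) * (A.card : ℝ) ^ 2 ≤
      ∑ a ∈ A, ∑ b ∈ A, ‖∑ j, E a j * (starRingEnd ℂ) (E b j)‖ ^ 2 := by
  rw [mcb_frob]
  have : ∀ j ∈ (Finset.univ : Finset (Fin N)), (A.card : ℝ) ^ 2 ≤
      ∑ k, ‖∑ a ∈ A, E a j * (starRingEnd ℂ) (E a k)‖ ^ 2 := by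
    intro j _
    have h := Finset.single_le_sum (s := Finset.univ)
      (f := fun k => ‖∑ a ∈ A, E a j * (starRingEnd ℂ) (E a k)‖ ^ 2)
      (fun k _ => by positivity) (Finset.mem_univ j)
    refine le_trans (le_of_eq ?_) h
    simp [Complex.mul_conj, Complex.normSq_eq_norm_sq, hE]
  simpa using Finset.card_nsmul_le_sum _ _ _ this

lemma mcb_finite (U : Set (ℝ × ℝ)) (hU : Bornology.IsBounded U) :
    {m : ℤ × ℤ | toR2 m ∈ U}.Finite := by
  obtain ⟨R, hR⟩ := hU.subset_closedBall 0
  refine Set.Finite.subset (Set.finite_Icc ((-⌈R⌉, -⌈R⌉) : ℤ × ℤ) (⌈R⌉, ⌈R⌉)) ?_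
  intro m hm
  have h := hR hm
  rw [mem_closedBall_zero_iff, Prod.norm_def, max_le_iff] at h
  simp only [toR2, Real.norm_eq_abs, abs_le] at h
  have hc := Int.le_ceil R
  obtain ⟨⟨h1, h2⟩, h3, h4⟩ := h
  refine ⟨⟨?_, ?_⟩, ⟨?_, ?_⟩⟩ <;> simp only <;> rify <;> linarith

/-- Blichfeldt-type averaging. -/
lemma mcb_blichfeldt (V : Set (ℝ × ℝ)) (hV : IsCompact V) :
    ∃ (x : ℝ × ℝ) (A : Finset (ℤ × ℤ)), (∀ a ∈ A, x + toR2 a ∈ V) ∧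
      (volume V).toReal ≤ A.card := by
  classical
  set F : Set (ℝ × ℝ) := Set.Ico 0 1 ×ˢ Set.Ico 0 1 with hF
  have hFm : MeasurableSet F := measurableSet_Ico.prod measurableSet_Ico
  have hFv : volume F = 1 := by
    rw [hF, Measure.volume_eq_prod, Measure.prod_prod]; simp
  have hVm : MeasurableSet V := hV.measurableSet
  obtain ⟨R, hR⟩ := hV.isBounded.subset_closedBall 0
  have hfin := mcb_finite (Metric.closedBall 0 (R + 1)) Metric.isBounded_closedBall
  set S := hfin.toFinset with hS
  have hcov : V ⊆ ⋃ n ∈ S, (V ∩ (fun x => x - toR2 n) ⁻¹' F) := by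
    intro v hv
    have hx : v - toR2 (⌊v.1⌋, ⌊v.2⌋) ∈ F := by
      refine ⟨⟨?_, ?_⟩, ⟨?_, ?_⟩⟩ <;> simp only [toR2, Prod.fst_sub, Prod.snd_sub]
      · linarith [Int.floor_le v.1]
      · linarith [Int.lt_floor_add_one v.1]
      · linarith [Int.floor_le v.2]
      · linarith [Int.lt_floor_add_one v.2]
    simp only [Set.mem_iUnion]
    refine ⟨(⌊v.1⌋, ⌊v.2⌋), ?_, hv, hx⟩
    rw [hS, Set.Finite.mem_toFinset, Set.mem_ofPred_eq, mem_closedBall_zero_iff]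
    have h1 := hR hv
    rw [mem_closedBall_zero_iff] at h1
    have h2 : ‖v - toR2 (⌊v.1⌋, ⌊v.2⌋)‖ ≤ 1 := by
      obtain ⟨⟨a, b⟩, c, d⟩ := hx
      rw [Prod.norm_def, max_le_iff, Real.norm_eq_abs, Real.norm_eq_abs, abs_le, abs_le]
      refine ⟨⟨?_, ?_⟩, ?_, ?_⟩ <;> linarith
    have h3 := norm_sub_norm_le (toR2 (⌊v.1⌋, ⌊v.2⌋)) v
    rw [norm_sub_rev] at h3
    linarith
  have hmeas : volume V ≤ ∑ n ∈ S, volume (((fun x => x + toR2 n) ⁻¹' V) ∩ F) := by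
    refine (measure_mono hcov).trans ((measure_biUnion_finset_le _ _).trans ?_)
    refine Finset.sum_le_sum fun n _ => le_of_eq ?_
    rw [← measure_preimage_add_right volume (toR2 n) (V ∩ (fun x => x - toR2 n) ⁻¹' F)]
    congr 1
    ext x
    simp
  have hint : ∑ n ∈ S, volume (((fun x => x + toR2 n) ⁻¹' V) ∩ F) =
      ∫⁻ x in F, ((S.filter fun n => x + toR2 n ∈ V).card : ENNReal) := by
    have hms : ∀ n, MeasurableSet ((fun x => x + toR2 n) ⁻¹' V) := fun n =>
      (measurable_add_const (toR2 n)) hVm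
    have : ∀ x : ℝ × ℝ, ((S.filter fun n => x + toR2 n ∈ V).card : ENNReal) =
        ∑ n ∈ S, ((fun x => x + toR2 n) ⁻¹' V).indicator (fun _ => (1 : ENNReal)) x := by
      intro x
      rw [Finset.card_filter]
      push_cast
      refine Finset.sum_congr rfl fun n _ => ?_
      simp [Set.indicator_apply]
    simp_rw [this]
    rw [lintegral_finsetSum _ (fun n _ => measurable_const.indicator (hms n))]
    refine Finset.sum_congr rfl fun n _ => ?_
    rw [lintegral_indicator_const (hms n), Measure.restrict_apply (hms n), one_mul]
  by_contra! hcon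
  have hlt : ∀ x, ((S.filter fun n => x + toR2 n ∈ V).card : ℝ) < (volume V).toReal := fun x =>
    hcon x _ (by intro a ha; exact (Finset.mem_filter.mp ha).2)
  have hVfin : volume V ≠ ⊤ := hV.measure_lt_top.ne
  set k : ℕ := ⌈(volume V).toReal⌉₊ - 1 with hk
  have hpos : 0 < (volume V).toReal := lt_of_le_of_lt (Nat.cast_nonneg _) (hlt 0)
  have hceil : 0 < ⌈(volume V).toReal⌉₊ := Nat.ceil_pos.mpr hpos
  have hle : ∀ x, (S.filter fun n => x + toR2 n ∈ V).card ≤ k := fun x => by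
    have := Nat.lt_ceil.mpr (hlt x)
    omega
  have hklt : (k : ℝ) < (volume V).toReal := Nat.lt_ceil.mp (by omega)
  have hfinal : volume V ≤ (k : ENNReal) := by
    rw [hint] at hmeas
    refine hmeas.trans ?_
    calc _ ≤ ∫⁻ x in F, (k : ENNReal) := lintegral_mono fun x => Nat.cast_le.mpr (hle x)
      _ = k := by simp [hFv]
  have := ENNReal.toReal_mono (by simp) hfinal
  simp at this
  linarith

theorem montgomery_convex_body_lower_bound
    (B : Set (ℝ × ℝ)) (hBopen : IsOpen B) (hBbdd : Bornology.IsBounded B)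
    (hB0 : (0 : ℝ × ℝ) ∈ B) :
    ∃ c > (0:ℝ), ∀ U : Set (ℝ × ℝ),
      IsCompact U → Convex ℝ U → (interior U).Nonempty → U = -U →
      ∀ N : ℕ, ∀ p : Fin N → AddCircle (1:ℝ) × AddCircle (1:ℝ),
      (N : ℝ) * (volume U).toReal / 4 - c * (N : ℝ) ^ 2 ≤
        ∑ᶠ m ∈ {m : ℤ × ℤ | toR2 m ∈ U \ B},
          ‖∑ j : Fin N, fourier m.1 (p j).1 * fourier m.2 (p j).2‖ ^ 2 := by
  classical
  have hBf := mcb_finite B hBbdd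
  set T0 := hBf.toFinset with hT0
  refine ⟨(T0.card : ℝ) + 1, by positivity, ?_⟩
  intro U hUc hUconv _ hUsym N p
  have hUf := mcb_finite U hUc.isBounded
  set T := hUf.toFinset with hT
  have hDf : {m : ℤ × ℤ | toR2 m ∈ U \ B}.Finite := hUf.subset fun m hm => hm.1
  set e : ℤ × ℤ → Fin N → ℂ := fun m j => fourier m.1 (p j).1 * fourier m.2 (p j).2 with he
  set f : ℤ × ℤ → ℝ := fun m => ‖∑ j, e m j‖ ^ 2 with hf
  have hf0 : ∀ m, 0 ≤ f m := fun m => by positivity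
  have he1 : ∀ m j, ‖e m j‖ = 1 := by
    intro m j
    simp [he, fourier_apply, Circle.norm_coe]
  have hfN : ∀ m, f m ≤ (N : ℝ) ^ 2 := by
    intro m
    have : ‖∑ j, e m j‖ ≤ N := by
      refine (norm_sum_le _ _).trans (le_of_eq ?_)
      simp [he1]
    exact pow_le_pow_left₀ (norm_nonneg _) this 2
  rw [finsum_mem_eq_finite_toFinset_sum _ hDf]
  change _ ≤ ∑ m ∈ hDf.toFinset, f m
  -- splitting
  have hsplit : ∑ m ∈ T, f m ≤ ∑ m ∈ hDf.toFinset, f m + T0.card * (N : ℝ) ^ 2 := by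
    have h1 : ∑ m ∈ T, f m ≤ ∑ m ∈ hDf.toFinset ∪ T0, f m := by
      refine Finset.sum_le_sum_of_subset_of_nonneg ?_ fun m _ _ => hf0 m
      intro m hm
      simp only [hT, hT0, Finset.mem_union, Set.Finite.mem_toFinset, Set.mem_ofPred_eq,
        Set.mem_sdiff] at hm ⊢
      tauto
    have h2 : ∑ m ∈ hDf.toFinset ∪ T0, f m ≤ ∑ m ∈ hDf.toFinset, f m + ∑ m ∈ T0, f m := by
      rw [← Finset.sum_union_inter]
      exact le_add_of_nonneg_right (Finset.sum_nonneg fun m _ => hf0 m)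
    have h3 : ∑ m ∈ T0, f m ≤ T0.card * (N : ℝ) ^ 2 := by
      simpa using Finset.sum_le_card_nsmul T0 f _ fun m _ => hfN m
    linarith
  -- main bound
  have hmain : (N : ℝ) * (volume U).toReal / 4 ≤ ∑ m ∈ T, f m := by
    obtain ⟨x, A, hA, hcard⟩ := mcb_blichfeldt (Set.image (fun u => (1 / 2 : ℝ) • u) U)
      (hUc.image (continuous_const_smul _))
    have hvol : (volume (Set.image (fun u => (1 / 2 : ℝ) • u) U)).toReal = (volume U).toReal / 4 := by
      rw [Set.image_smul, Measure.addHaar_smul, ENNReal.toReal_mul, ENNReal.toReal_ofReal (abs_nonneg _)]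
      simp
      norm_num
      ring
    rw [hvol] at hcard
    have hdiff : ∀ a ∈ A, ∀ b ∈ A, a - b ∈ T := by
      intro a ha b hb
      obtain ⟨u, hu, hua⟩ := hA a ha
      obtain ⟨v, hv, hvb⟩ := hA b hb
      have hvneg : -v ∈ U := by rw [hUsym]; simpa using hv
      have := hUconv hu hvneg (a := 1 / 2) (b := 1 / 2) (by norm_num) (by norm_num) (by norm_num)
      simp only [hT, Set.Finite.mem_toFinset, Set.mem_ofPred_eq]
      convert this using 1
      simp only at hua hvb
      rw [hua, smul_neg, hvb]
      ext <;> simp [toR2] <;> ring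
    have hd := mcb_diag A N e he1
    have hee : ∀ a b j, e a j * (starRingEnd ℂ) (e b j) = e (a - b) j := by
      intro a b j
      simp only [he, map_mul, ← fourier_neg, sub_eq_add_neg, Prod.fst_add, Prod.snd_add,
        Prod.fst_neg, Prod.snd_neg,
        fourier_add]
      ring
    simp_rw [hee] at hd
    have hub : ∑ a ∈ A, ∑ b ∈ A, f (a - b) ≤ A.card * ∑ m ∈ T, f m := by
      rw [← nsmul_eq_mul]
      refine Finset.sum_le_card_nsmul _ _ _ fun a ha => ?_
      rw [← Finset.sum_image (f := f) (g := fun b => a - b) (fun b _ c _ h => sub_right_injective h)]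
      refine Finset.sum_le_sum_of_subset_of_nonneg ?_ fun m _ _ => hf0 m
      intro m hm
      obtain ⟨b, hb, rfl⟩ := Finset.mem_image.mp hm
      exact hdiff a ha b hb
    have hle : (N : ℝ) * (A.card : ℝ) ^ 2 ≤ A.card * ∑ m ∈ T, f m := hd.trans hub
    have hTs : 0 ≤ ∑ m ∈ T, f m := Finset.sum_nonneg fun m _ => hf0 m
    have hNA : (N : ℝ) * A.card ≤ ∑ m ∈ T, f m := by
      rcases (Nat.cast_nonneg A.card : (0 : ℝ) ≤ A.card).eq_or_lt with h | h
      · rw [← h]; simpa using hTs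
      · refine le_of_mul_le_mul_left ?_ h
        linarith
    have := mul_le_mul_of_nonneg_left hcard (Nat.cast_nonneg N : (0 : ℝ) ≤ N)
    linarith
  nlinarith [sq_nonneg (N : ℝ)]
end
end

section
/- For every convex body C ⊂ ℝ² there exist δ₀ > 0 and c > 0 such that for every 0 < δ < δ₀ and every unit vector Θ ∈ ℝ², the chord γ_Θ(δ) = {x ∈ C : x·Θ = inf_{y∈C} y·Θ + δ} has length |γ_Θ(δ)| ≥ c·δ. -/
open Real MeasureTheory Set
open scoped RealInnerProductSpace

noncomputable section

/-- The Euclidean plane. -/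
abbrev E2 := EuclideanSpace ℝ (Fin 2)

/-- The chord `γ_Θ(δ) = {x ∈ C : x·Θ = inf_{y ∈ C} y·Θ + δ}`. -/
def chord (C : Set E2) (Θ : E2) (δ : ℝ) : Set E2 :=
  {x ∈ C | ⟪x, Θ⟫ = sInf ((fun y => ⟪y, Θ⟫) '' C) + δ}

/-- **Chord growth for convex bodies.** For every convex body `C ⊆ ℝ²` there are `δ₀, c > 0`
such that for every `0 < δ < δ₀` and every unit vector `Θ`, the chord `γ_Θ(δ)` has length
at least `c δ`. -/
theorem chord_length_lower_bound
    (C : Set E2) (hC : IsCompact C) (hconv : Convex ℝ C) (hint : (interior C).Nonempty) :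
    ∃ δ₀ > (0:ℝ), ∃ c > (0:ℝ), ∀ δ : ℝ, 0 < δ → δ < δ₀ →
      ∀ Θ : E2, ‖Θ‖ = 1 → c * δ ≤ (μH[1] (chord C Θ δ)).toReal := by
  obtain ⟨p, hp⟩ := hint
  obtain ⟨r, hr, hball⟩ := Metric.nhds_basis_closedBall.mem_iff.1 (mem_interior_iff_mem_nhds.1 hp)
  have hpC : p ∈ C := interior_subset hp
  obtain ⟨R, hR⟩ := hC.isBounded.subset_closedBall p
  have hR' : ∀ x ∈ C, ‖x - p‖ ≤ R := fun x hx => by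
    have := hR hx
    rwa [Metric.mem_closedBall, dist_eq_norm] at this
  have hbr : ∀ v : E2, ‖v‖ ≤ r → p + v ∈ C := fun v hv => hball (by
    simpa [Metric.mem_closedBall, dist_eq_norm] using hv)
  have key : ∀ Θ : E2, ‖Θ‖ = 1 → ∃ y₀ ∈ C, ⟪y₀, Θ⟫ = sInf ((fun y => ⟪y, Θ⟫) '' C) ∧
      r ≤ ⟪p, Θ⟫ - ⟪y₀, Θ⟫ ∧ ⟪p, Θ⟫ - ⟪y₀, Θ⟫ ≤ R := by
    intro Θ hΘ
    have hcont : ContinuousOn (fun y : E2 => ⟪y, Θ⟫) C := by fun_prop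
    obtain ⟨y₀, hy₀, heq, hle⟩ := hC.exists_sInf_image_eq_and_le ⟨p, hpC⟩ hcont
    refine ⟨y₀, hy₀, heq.symm, ?_, ?_⟩
    · have h1 := hle (p + (-r) • Θ) (hbr _ (by rw [norm_smul, hΘ]; simp [abs_of_pos hr]))
      simp only [inner_add_left, real_inner_smul_left, real_inner_self_eq_norm_sq, hΘ] at h1
      linarith
    · have h1 := real_inner_le_norm (p - y₀) Θ
      rw [inner_sub_left, hΘ, norm_sub_rev] at h1
      linarith [hR' y₀ hy₀]
  have hRpos : 0 < R := by
    obtain ⟨y₀, -, -, h1, h2⟩ := key (EuclideanSpace.single 0 1) (by simp)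
    linarith
  refine ⟨r, hr, r / R, by positivity, ?_⟩
  intro δ hδ hδr Θ hΘ
  obtain ⟨y₀, hy₀, hm, hrh, hhR⟩ := key Θ hΘ
  set h := ⟪p, Θ⟫ - ⟪y₀, Θ⟫ with hh
  have hpos : 0 < h := by linarith
  set t := δ / h with ht
  have ht0 : 0 < t := by positivity
  have ht1 : t ≤ 1 := by rw [ht, div_le_one hpos]; linarith
  have hth : t * h = δ := by rw [ht]; field_simp
  have hn : Θ 0 ^ 2 + Θ 1 ^ 2 = 1 := by
    have := EuclideanSpace.real_norm_sq_eq Θ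
    rw [hΘ, Fin.sum_univ_two] at this
    linarith
  set e : E2 := !₂[-Θ 1, Θ 0] with he
  have hen : ‖e‖ = 1 := by
    have := EuclideanSpace.real_norm_sq_eq e
    rw [Fin.sum_univ_two] at this
    simp [he] at this
    nlinarith [norm_nonneg e]
  have heΘ : ⟪e, Θ⟫ = 0 := by
    simp [he, PiLp.inner_apply, Fin.sum_univ_two]
    ring
  set q : E2 := y₀ + t • (p - y₀) with hq
  have hqΘ : ⟪q, Θ⟫ = ⟪y₀, Θ⟫ + δ := by
    rw [hq, inner_add_left, real_inner_smul_left, inner_sub_left, ← hth]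
  have hseg : ∀ s ∈ Icc 0 (t * r), q + s • e ∈ chord C Θ δ := by
    intro s hs
    refine ⟨?_, ?_⟩
    · have h1 : p + (s / t) • e ∈ C := hbr _ (by
        rw [norm_smul, hen, mul_one, Real.norm_of_nonneg (div_nonneg hs.1 ht0.le),
          div_le_iff₀ ht0]
        linarith [hs.2])
      have h2 := hconv hy₀ h1 (sub_nonneg.2 ht1) ht0.le (by ring)
      convert h2 using 1
      rw [smul_add, smul_smul, mul_div_cancel₀ _ ht0.ne', hq]
      module
    · rw [inner_add_left, real_inner_smul_left, heΘ, hqΘ, hm]; ring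
  have hqC : q ∈ C := by
    have := (hseg 0 ⟨le_rfl, by positivity⟩).1
    simpa using this
  have hiso : Isometry (fun s : ℝ => q + s • e) := by
    refine Isometry.of_dist_eq fun a b => ?_
    rw [dist_add_left, dist_eq_norm, ← sub_smul, norm_smul, hen, mul_one, ← dist_eq_norm]
  have hsub1 : (fun s : ℝ => q + s • e) '' Icc 0 (t * r) ⊆ chord C Θ δ := by
    rintro _ ⟨s, hs, rfl⟩
    exact hseg s hs
  have hsub2 : chord C Θ δ ⊆ (fun s : ℝ => q + s • e) '' Icc (-(2 * R)) (2 * R) := by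
    rintro x ⟨hxC, hx⟩
    have h0 : ⟪x - q, Θ⟫ = 0 := by rw [inner_sub_left, hqΘ, hx, hm]; ring
    simp only [PiLp.inner_apply, Fin.sum_univ_two] at h0
    simp at h0
    obtain ⟨s, hs⟩ : ∃ s : ℝ, x - q = s • e := by
      refine ⟨-(x 0 - q 0) * Θ 1 + (x 1 - q 1) * Θ 0, ?_⟩
      ext i
      fin_cases i
      · simp [he]
        linear_combination (-(x 0 - q 0)) * hn + Θ 0 * h0
      · simp [he]
        linear_combination (-(x 1 - q 1)) * hn + Θ 1 * h0
    refine ⟨s, ?_, ?_⟩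
    · have h1 : ‖x - q‖ ≤ 2 * R := by
        have : x - q = (x - p) - (q - p) := by abel
        rw [this]
        linarith [norm_sub_le (x - p) (q - p), hR' x hxC, hR' q hqC]
      rw [hs, norm_smul, hen, mul_one, Real.norm_eq_abs] at h1
      exact abs_le.1 h1
    · simp only [← hs]; abel
  have hfin : μH[1] (chord C Θ δ) ≠ ⊤ := by
    refine ne_top_of_le_ne_top ?_ (measure_mono hsub2)
    rw [hiso.hausdorffMeasure_image (Or.inl zero_le_one), hausdorffMeasure_real, Real.volume_Icc]
    exact ENNReal.ofReal_ne_top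
  have hlow : ENNReal.ofReal (t * r) ≤ μH[1] (chord C Θ δ) := by
    refine le_trans (le_of_eq ?_) (measure_mono hsub1)
    rw [hiso.hausdorffMeasure_image (Or.inl zero_le_one), hausdorffMeasure_real, Real.volume_Icc,
      sub_zero]
  have h3 := (ENNReal.ofReal_le_iff_le_toReal hfin).1 hlow
  refine le_trans ?_ h3
  rw [ht, div_mul_eq_mul_div, div_mul_eq_mul_div, mul_comm r δ]
  exact div_le_div_of_nonneg_left (by positivity) hpos hhR
end
end
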